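/- There is no continuous function r : ℝ⁴ → ℂ such that for every (a₀, a₁, a₂, a₃) ∈ ℝ⁴, the value r(a₀, a₁, a₂, a₃) is a root of the polynomial z⁴ + a₃z³ + a₂z² + a₁z + a₀. -/

import Mathlib

lemma aux_const_sign (f : ℝ → ℝ) (hf : Continuous f) (a b : ℝ) (ha : f a < 0) (hb : 0 < f b) :
    ∃ c, f c = 0 := by
  have := mem_range_of_exists_le_of_exists_ge hf ⟨a, ha.le⟩ ⟨b, hb.le⟩
  exact this

lemma aux_no_sqrt (F : ℝ → ℂ) (hF : Continuous F)
    (h : ∀ t : ℝ, (F t - Complex.I) ^ 2 = Complex.exp (t * Complex.I) / 4)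
    (h0 : F 0 = F (2 * Real.pi)) : False := by
  set g : ℝ → ℂ := fun t => 2 * (F t - Complex.I) * Complex.exp (-(t / 2 * Complex.I)) with hg
  have hgc : Continuous g := by fun_prop
  have hsq : ∀ t, g t ^ 2 = 1 := by
    intro t
    have : g t ^ 2 = 4 * (F t - Complex.I) ^ 2 * Complex.exp (-(t / 2 * Complex.I)) ^ 2 := by
      simp only [hg]; ring
    rw [this, h, ← Complex.exp_nat_mul]
    have e : 4 * (Complex.exp (t * Complex.I) / 4) = Complex.exp (t * Complex.I) := by ring
    rw [e, ← Complex.exp_add, ← Complex.exp_zero]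
    congr 1
    push_cast
    ring
  have hre : ∀ t, (g t).re ≠ 0 := by
    intro t ht
    rcases (sq_eq_sq_iff_eq_or_eq_neg.mp ((hsq t).trans (one_pow 2).symm)) with h | h <;> simp [h] at ht
  have hneg : g (2 * Real.pi) = - g 0 := by
    simp only [hg]
    rw [← h0]
    have : Complex.exp (-(((2 * Real.pi : ℝ) : ℂ) / 2 * Complex.I)) = -1 := by
      have : -(((2 * Real.pi : ℝ) : ℂ) / 2 * Complex.I) = -(Real.pi * Complex.I) := by
        push_cast; ring
      rw [this, Complex.exp_neg, Complex.exp_pi_mul_I]; norm_num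
    rw [this]; simp
  have hneg' : (g (2 * Real.pi)).re = - (g 0).re := by rw [hneg]; simp
  have hc : Continuous fun t => (g t).re := Complex.continuous_re.comp hgc
  rcases lt_or_gt_of_ne (hre 0) with h1 | h1
  · obtain ⟨c, hc⟩ := aux_const_sign _ hc 0 (2 * Real.pi) h1 (by linarith)
    exact hre c hc
  · obtain ⟨c, hc⟩ := aux_const_sign _ hc (2 * Real.pi) 0 (by linarith) h1
    exact hre c hc

lemma aux_im_pos (z : ℂ) (t : ℝ) (h : (z - Complex.I) ^ 2 = Complex.exp (t * Complex.I) / 4) :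
    0 < z.im := by
  have h1 : ‖z - Complex.I‖ ^ 2 = 1 / 4 := by
    rw [← norm_pow, h, norm_div, Complex.norm_exp_ofReal_mul_I]; norm_num
  have h2 := Complex.abs_im_le_norm (z - Complex.I)
  have h3 : ‖z - Complex.I‖ < 1 := by nlinarith [norm_nonneg (z - Complex.I)]
  have h4 := (abs_lt.mp (h2.trans_lt h3)).1
  simp at h4
  linarith

/-- There is no continuous function `r : ℝ⁴ → ℂ` such that `r (a₀, a₁, a₂, a₃)` is a root of
`z⁴ + a₃z³ + a₂z² + a₁z + a₀` for all `(a₀, a₁, a₂, a₃) ∈ ℝ⁴`. -/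
theorem no_continuous_root_quartic_real :
    ¬ ∃ r : ℝ × ℝ × ℝ × ℝ → ℂ, Continuous r ∧
      ∀ a₀ a₁ a₂ a₃ : ℝ,
        (r (a₀, a₁, a₂, a₃)) ^ 4 + (a₃ : ℂ) * (r (a₀, a₁, a₂, a₃)) ^ 3
          + (a₂ : ℂ) * (r (a₀, a₁, a₂, a₃)) ^ 2 + (a₁ : ℂ) * r (a₀, a₁, a₂, a₃)
          + (a₀ : ℂ) = 0 := by
  rintro ⟨r, hr, h⟩
  set F : ℝ → ℂ := fun t => r ((1 + Real.cos t / 4) ^ 2 + (Real.sin t / 4) ^ 2,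
    Real.sin t, 2 - Real.cos t / 2, 0) with hFdef
  have hF : Continuous F := by fun_prop
  have h0 : F 0 = F (2 * Real.pi) := by simp [hFdef]
  have key : ∀ t : ℝ, (F t - Complex.I) ^ 2 = Complex.exp (t * Complex.I) / 4 ∨
      ((starRingEnd ℂ) (F t) - Complex.I) ^ 2 = Complex.exp (t * Complex.I) / 4 := by
    intro t
    have ht : F t ^ 4 + _ * F t ^ 3 + _ * F t ^ 2 + _ * F t + _ = 0 := h _ _ _ _
    have hexp : Complex.exp (t * Complex.I) = (Real.cos t : ℂ) + Real.sin t * Complex.I := by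
      rw [Complex.exp_mul_I]; push_cast; rfl
    rw [hexp]
    generalize F t = z at ht ⊢
    generalize Real.cos t = p at ht ⊢
    generalize Real.sin t = q at ht ⊢
    push_cast at ht
    have hI : Complex.I ^ 2 = -1 := Complex.I_sq
    have : ((z - Complex.I) ^ 2 - (p + q * Complex.I) / 4) *
        ((z + Complex.I) ^ 2 - (p - q * Complex.I) / 4) = 0 := by
      have e1 : (z - Complex.I) ^ 2 - (p + q * Complex.I) / 4 =
        (z ^ 2 - 1 - p / 4) - (2 * z + q / 4) * Complex.I := by linear_combination hI
      have e2 : (z + Complex.I) ^ 2 - (p - q * Complex.I) / 4 =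
        (z ^ 2 - 1 - p / 4) + (2 * z + q / 4) * Complex.I := by linear_combination hI
      rw [e1, e2]
      linear_combination ht - (2 * z + q / 4) ^ 2 * hI
    rcases mul_eq_zero.mp this with h | h
    · left; linear_combination h
    · right
      have := congrArg (starRingEnd ℂ) h
      have h4 : (starRingEnd ℂ) 4 = 4 := Complex.conj_ofNat 4
      simp [h4] at this
      linear_combination this
  have him : ∀ t, (F t).im ≠ 0 := by
    intro t ht
    rcases key t with h | h
    · exact (aux_im_pos _ _ h).ne' ht
    · have := aux_im_pos _ _ h
      simp [ht] at this
  have hc : Continuous fun t => (F t).im := Complex.continuous_im.comp hF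
  by_cases hpos : ∃ b, 0 < (F b).im
  · obtain ⟨b, hb⟩ := hpos
    refine aux_no_sqrt F hF (fun t => ?_) h0
    rcases key t with h | h
    · exact h
    · have := aux_im_pos _ _ h
      simp at this
      obtain ⟨c, hc⟩ := aux_const_sign _ hc t b this hb
      exact absurd hc (him c)
  · refine aux_no_sqrt (fun t => (starRingEnd ℂ) (F t)) (Complex.continuous_conj.comp hF)
      (fun t => ?_) (by simp only [h0])
    rcases key t with h | h
    · exact absurd ⟨t, aux_im_pos _ _ h⟩ hpos
    · exact h
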